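/- Let (T(t))_{t>0} be an injective and contractive *-semigroup on L∞(E,m) such that every operator T(t) is a positive strong Feller operator. Then for every f ∈ L∞(E,m) the map (0,∞) × E → ℝ, (t,x) ↦ (T(t)f)(x), is jointly continuous (where T(t)f is identified with its continuous representative). -/

import Mathlib

open MeasureTheory Filter Topology

variable {E : Type*}

/-- The weak* topology `σ(L∞, L¹)` on `L∞(E, m)`, induced by the pairings
`f ↦ ∫ f g dm`, `g ∈ L¹(E, m)`. -/
noncomputable def weakStarLinf [MeasurableSpace E] (m : MeasureTheory.Measure E) :
    TopologicalSpace (MeasureTheory.Lp ℝ ⊤ m) :=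
  TopologicalSpace.induced
    (fun (f : MeasureTheory.Lp ℝ ⊤ m) (g : MeasureTheory.Lp ℝ 1 m) =>
      ∫ x, (f : E → ℝ) x * (g : E → ℝ) x ∂m) inferInstance

namespace StrongFeller

section Duality

variable [MeasurableSpace E] {m : Measure E}

/-- The duality pairing between `L∞` and `L¹`. -/
noncomputable def pairing (f : Lp ℝ ⊤ m) (g : Lp ℝ 1 m) : ℝ :=
  ∫ x, (f : E → ℝ) x * (g : E → ℝ) x ∂m

lemma ae_abs_le_norm (f : Lp ℝ ⊤ m) : ∀ᵐ x ∂m, |(f : E → ℝ) x| ≤ ‖f‖ := by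
  have h := ae_le_eLpNormEssSup (f := (f : E → ℝ)) (μ := m)
  filter_upwards [h] with x hx
  rw [← eLpNorm_exponent_top] at hx
  have := ENNReal.toReal_mono (Lp.eLpNorm_ne_top f) hx
  simpa [Lp.norm_def] using this

lemma exists_Linf_of_bound {φ : E → ℝ} (hφ : Measurable φ) {C : ℝ} (hC : 0 ≤ C)
    (h : ∀ x, |φ x| ≤ C) : ∃ f : Lp ℝ ⊤ m, (f : E → ℝ) =ᵐ[m] φ ∧ ‖f‖ ≤ C := by
  have hm : MemLp φ ⊤ m :=
    memLp_top_of_bound hφ.aestronglyMeasurable C (Eventually.of_forall h)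
  refine ⟨hm.toLp φ, hm.coeFn_toLp, ?_⟩
  rw [Lp.norm_toLp, eLpNorm_exponent_top]
  exact ENNReal.toReal_le_of_le_ofReal hC
    (eLpNormEssSup_le_of_ae_bound (Eventually.of_forall h))

lemma integrable_mul_pairing (f : Lp ℝ ⊤ m) (g : Lp ℝ 1 m) :
    Integrable (fun x => (f : E → ℝ) x * (g : E → ℝ) x) m :=
  (L1.integrable_coeFn g).bdd_mul (Lp.aestronglyMeasurable f) (ae_abs_le_norm f)

lemma pairing_congr {f : Lp ℝ ⊤ m} {g : Lp ℝ 1 m} {φ ψ : E → ℝ}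
    (hf : (f : E → ℝ) =ᵐ[m] φ) (hg : (g : E → ℝ) =ᵐ[m] ψ) :
    pairing f g = ∫ x, φ x * ψ x ∂m :=
  integral_congr_ae (hf.mul hg)

lemma pairing_add_left (f₁ f₂ : Lp ℝ ⊤ m) (g : Lp ℝ 1 m) :
    pairing (f₁ + f₂) g = pairing f₁ g + pairing f₂ g := by
  rw [pairing_congr (Lp.coeFn_add f₁ f₂) (ae_eq_refl _), pairing, pairing,
    ← integral_add (integrable_mul_pairing _ _) (integrable_mul_pairing _ _)]
  simp [add_mul]

lemma pairing_smul_left (c : ℝ) (f : Lp ℝ ⊤ m) (g : Lp ℝ 1 m) :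
    pairing (c • f) g = c * pairing f g := by
  rw [pairing_congr (Lp.coeFn_smul c f) (ae_eq_refl _), pairing, ← integral_const_mul]
  simp [mul_assoc]

lemma pairing_sub_right (f : Lp ℝ ⊤ m) (g₁ g₂ : Lp ℝ 1 m) :
    pairing f (g₁ - g₂) = pairing f g₁ - pairing f g₂ := by
  rw [pairing_congr (ae_eq_refl _) (Lp.coeFn_sub g₁ g₂), pairing, pairing,
    ← integral_sub (integrable_mul_pairing _ _) (integrable_mul_pairing _ _)]
  simp [mul_sub]

lemma abs_pairing_le (f : Lp ℝ ⊤ m) (g : Lp ℝ 1 m) : |pairing f g| ≤ ‖f‖ * ‖g‖ := by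
  rw [L1.norm_eq_integral_norm, ← integral_const_mul]
  rw [← Real.norm_eq_abs, pairing]
  refine norm_integral_le_of_norm_le ((L1.integrable_coeFn g).norm.const_mul _) ?_
  filter_upwards [ae_abs_le_norm f] with x hx
  rw [norm_mul]
  exact mul_le_mul_of_nonneg_right hx (norm_nonneg _)

lemma tendsto_pairing {fs : ℕ → Lp ℝ ⊤ m} {f : Lp ℝ ⊤ m} {C : ℝ} (hC : ∀ n, ‖fs n‖ ≤ C)
    (h : ∀ᵐ x ∂m, Tendsto (fun n => (fs n : E → ℝ) x) atTop (𝓝 ((f : E → ℝ) x)))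
    (g : Lp ℝ 1 m) : Tendsto (fun n => pairing (fs n) g) atTop (𝓝 (pairing f g)) := by
  refine tendsto_integral_of_dominated_convergence (fun x => C * ‖(g : E → ℝ) x‖)
    (fun n => (integrable_mul_pairing _ _).aestronglyMeasurable)
    ((L1.integrable_coeFn g).norm.const_mul _) (fun n => ?_) ?_
  · filter_upwards [ae_abs_le_norm (fs n)] with x hx
    rw [norm_mul]
    exact mul_le_mul_of_nonneg_right (hx.trans (hC n)) (norm_nonneg _)
  · filter_upwards [h] with x hx using hx.mul_const _

lemma exists_pairing_eq_norm (g : Lp ℝ 1 m) :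
    ∃ f : Lp ℝ ⊤ m, ‖f‖ ≤ 1 ∧ pairing f g = ‖g‖ := by
  have hg : Measurable (g : E → ℝ) := (Lp.stronglyMeasurable g).measurable
  have hs : Measurable fun x => if 0 ≤ (g : E → ℝ) x then (1 : ℝ) else -1 :=
    Measurable.ite (measurableSet_le measurable_const hg) measurable_const measurable_const
  obtain ⟨f, hf, hf1⟩ := exists_Linf_of_bound (m := m) hs zero_le_one
    (fun x => by split_ifs <;> simp)
  refine ⟨f, hf1, ?_⟩
  rw [pairing_congr hf (ae_eq_refl _), L1.norm_eq_integral_norm]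
  refine integral_congr_ae (Eventually.of_forall fun x => ?_)
  dsimp only
  split_ifs with h
  · simp [abs_of_nonneg h]
  · simp [abs_of_neg (not_le.1 h)]

/-- In the separable case, countably many elements of the unit ball of `L∞` are norming
for `L¹`. -/
lemma exists_norming_seq [TopologicalSpace.SeparableSpace (Lp ℝ 1 m)] :
    ∃ φ : ℕ → Lp ℝ ⊤ m, (∀ n, ‖φ n‖ ≤ 1) ∧
      ∀ (g : Lp ℝ 1 m) (r : ℝ), (∀ n, |pairing (φ n) g| ≤ r) → ‖g‖ ≤ r := by
  choose φ hφ hφd using fun n => exists_pairing_eq_norm (TopologicalSpace.denseSeq (Lp ℝ 1 m) n)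
  refine ⟨φ, hφ, fun g r hr => le_of_forall_pos_le_add fun ε hε => ?_⟩
  obtain ⟨n, hn⟩ := (TopologicalSpace.denseRange_denseSeq (Lp ℝ 1 m)).exists_dist_lt g
    (half_pos hε)
  set d := TopologicalSpace.denseSeq (Lp ℝ 1 m) n
  have hd : ‖d - g‖ < ε / 2 := by rwa [dist_comm, dist_eq_norm] at hn
  have h1 : pairing (φ n) (d - g) ≤ ‖d - g‖ :=
    (le_abs_self _).trans ((abs_pairing_le _ _).trans
      (mul_le_of_le_one_left (norm_nonneg _) (hφ n)))
  rw [pairing_sub_right, hφd] at h1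
  have h2 := (le_abs_self _).trans (hr n)
  have h3 : ‖g‖ ≤ ‖d‖ + ‖d - g‖ := norm_le_norm_add_norm_sub d g
  linarith

/-- A linear functional on `L∞` that is sequentially continuous along bounded, almost
everywhere convergent sequences is represented by an element of `L¹`. -/
theorem exists_pairing_of_sigma_continuous [SigmaFinite m] (Λ : Lp ℝ ⊤ m →ₗ[ℝ] ℝ)
    (hΛ : ∀ (fs : ℕ → Lp ℝ ⊤ m) (f : Lp ℝ ⊤ m), (∃ C : ℝ, ∀ n, ‖fs n‖ ≤ C) →
      (∀ᵐ x ∂m, Tendsto (fun n => (fs n : E → ℝ) x) atTop (𝓝 ((f : E → ℝ) x))) →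
      Tendsto (fun n => Λ (fs n)) atTop (𝓝 (Λ f))) :
    ∃ g : Lp ℝ 1 m, ∀ f, Λ f = pairing f g := by
  classical
  have hI : ∀ A : Set E, ∃ f : Lp ℝ ⊤ m,
      (MeasurableSet A → (f : E → ℝ) =ᵐ[m] A.indicator fun _ => (1 : ℝ)) ∧ ‖f‖ ≤ 1 := by
    intro A
    by_cases hA : MeasurableSet A
    · obtain ⟨f, hf, hf1⟩ := exists_Linf_of_bound (m := m)
        (measurable_const.indicator hA : Measurable (A.indicator fun _ => (1 : ℝ)))
        zero_le_one (fun x => by by_cases hx : x ∈ A <;> simp [hx])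
      exact ⟨f, fun _ => hf, hf1⟩
    · exact ⟨0, fun h => absurd h hA, by simp⟩
  choose I hIae hI1 using hI
  have hInull : ∀ A, MeasurableSet A → m A = 0 → I A = 0 := by
    intro A hA h0
    rw [Lp.eq_zero_iff_ae_eq_zero]
    exact (hIae A hA).trans (indicator_meas_zero h0)
  have hIunion : ∀ A B, MeasurableSet A → MeasurableSet B → Disjoint A B →
      I (A ∪ B) = I A + I B := by
    intro A B hA hB hAB
    refine Lp.ext ?_
    filter_upwards [hIae _ (hA.union hB), hIae A hA, hIae B hB, Lp.coeFn_add (I A) (I B)]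
      with x h1 h2 h3 h4
    rw [h4, h1, Set.indicator_union_of_disjoint hAB, Pi.add_apply, h2, h3]
  have hIfin : ∀ A : ℕ → Set E, (∀ i, MeasurableSet (A i)) →
      Pairwise (Function.onFun Disjoint A) → ∀ s : Finset ℕ,
      ∑ i ∈ s, I (A i) = I (⋃ i ∈ s, A i) := by
    intro A hA hd s
    induction s using Finset.induction_on with
    | empty => simpa using (hInull ∅ MeasurableSet.empty measure_empty).symm
    | insert a s ha ih =>
      rw [Finset.sum_insert ha, ih, Finset.set_biUnion_insert,
        hIunion _ _ (hA a) (s.measurableSet_biUnion fun i _ => hA i)]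
      rw [Set.disjoint_iUnion₂_right]
      exact fun i hi => hd (ne_of_mem_of_not_mem hi ha).symm
  let ν : SignedMeasure E :=
    { measureOf' := fun A => if MeasurableSet A then Λ (I A) else 0
      empty' := by simp [hInull ∅ MeasurableSet.empty measure_empty]
      not_measurable' := fun A hA => if_neg hA
      m_iUnion' := by
        intro A hA hd
        simp only [hA, MeasurableSet.iUnion hA, if_true]
        rw [HasSum, SummationFilter.unconditional_filter]
        simp only [← map_sum, hIfin A hA hd]
        refine tendsto_of_seq_tendsto fun s hs => ?_
        refine hΛ _ _ ⟨1, fun n => hI1 _⟩ ?_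
        have h1 : ∀ᵐ x ∂m, ∀ n, (I (⋃ i ∈ s n, A i) : E → ℝ) x =
            (⋃ i ∈ s n, A i).indicator (fun _ => (1 : ℝ)) x :=
          ae_all_iff.2 fun n => hIae _ ((s n).measurableSet_biUnion fun i _ => hA i)
        filter_upwards [h1, hIae _ (MeasurableSet.iUnion hA)] with x hx hx'
        simp only [hx, hx']
        exact ((tendsto_indicator_biUnion_finset A (fun _ => (1 : ℝ)) x).mono_right
          (pure_le_nhds _)).comp hs }
  have hν : ∀ A, MeasurableSet A → ν A = Λ (I A) := fun A hA => if_pos hA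
  have hac : ν ≪ᵥ m.toENNRealVectorMeasure := by
    refine VectorMeasure.AbsolutelyContinuous.mk fun A hA h0 => ?_
    rw [Measure.toENNRealVectorMeasure_apply_measurable hA] at h0
    rw [hν A hA, hInull A hA h0, map_zero]
  have hrn := (SignedMeasure.absolutelyContinuous_iff_withDensityᵥ_rnDeriv_eq ν m).1 hac
  have hint := SignedMeasure.integrable_rnDeriv ν m
  have hIpair : ∀ A, MeasurableSet A → Λ (I A) = pairing (I A) (hint.toL1 _) := by
    intro A hA
    have hA' := congrArg (fun v : SignedMeasure E => v A) hrn
    rw [← hν A hA, ← hA', withDensityᵥ_apply hint hA,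
      pairing_congr (hIae A hA) hint.coeFn_toL1, ← integral_indicator hA]
    congr 1 with x
    by_cases hx : x ∈ A <;> simp [hx]
  have hsimple : ∀ (φ : SimpleFunc E ℝ) (f : Lp ℝ ⊤ m), (f : E → ℝ) =ᵐ[m] φ →
      Λ f = pairing f (hint.toL1 _) := by
    intro φ
    induction φ using SimpleFunc.induction with
    | @const c A hA =>
      intro f hf
      have : f = c • I A := by
        refine Lp.ext ?_
        filter_upwards [hf, hIae A hA, Lp.coeFn_smul c (I A)] with x h1 h2 h3
        rw [h3, Pi.smul_apply, h2, h1]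
        by_cases hx : x ∈ A <;> simp [hx]
      rw [this, map_smul, pairing_smul_left, hIpair A hA, smul_eq_mul]
    | @add φ ψ _ hφ hψ =>
      intro f hf
      obtain ⟨C, hC⟩ := φ.exists_forall_norm_le
      obtain ⟨f₁, h₁, -⟩ := exists_Linf_of_bound (m := m) φ.measurable (le_max_right C 0)
        fun x => (hC x).trans (le_max_left _ _)
      obtain ⟨D, hD⟩ := ψ.exists_forall_norm_le
      obtain ⟨f₂, h₂, -⟩ := exists_Linf_of_bound (m := m) ψ.measurable (le_max_right D 0)
        fun x => (hD x).trans (le_max_left _ _)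
      have : f = f₁ + f₂ := by
        refine Lp.ext ?_
        filter_upwards [hf, h₁, h₂, Lp.coeFn_add f₁ f₂] with x h1 h2 h3 h4
        rw [h4, Pi.add_apply, h1, h2, h3, SimpleFunc.coe_add, Pi.add_apply]
      rw [this, map_add, pairing_add_left, hφ f₁ h₁, hψ f₂ h₂]
  refine ⟨hint.toL1 _, fun f => ?_⟩
  have hfm := Lp.stronglyMeasurable f
  choose fs hfs hfsC using fun n => exists_Linf_of_bound (m := m)
    (hfm.approxBounded ‖f‖ n).measurable (norm_nonneg f)
    (hfm.norm_approxBounded_le (norm_nonneg f) n)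
  have hlim : ∀ᵐ x ∂m, Tendsto (fun n => (fs n : E → ℝ) x) atTop (𝓝 ((f : E → ℝ) x)) := by
    filter_upwards [ae_all_iff.2 hfs, ae_abs_le_norm f] with x hx hxf
    simp only [hx]
    exact hfm.tendsto_approxBounded_of_norm_le hxf
  refine tendsto_nhds_unique (hΛ fs f ⟨_, hfsC⟩ hlim) ?_
  simp only [fun n => hsimple _ _ (hfs n)]
  exact tendsto_pairing hfsC hlim _

/-- A weak*-measurable contractive semigroup on `L∞` with a pre-adjoint on a separable `L¹` is
weak*-continuous on `(0, ∞)`. -/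
theorem continuousAt_pairing_semigroup [TopologicalSpace.SeparableSpace (Lp ℝ 1 m)]
    {T : ℝ → Lp ℝ ⊤ m →L[ℝ] Lp ℝ ⊤ m}
    (hsg : ∀ t s : ℝ, 0 < t → 0 < s → T (t + s) = (T t).comp (T s))
    (hmeas : ∀ (f : Lp ℝ ⊤ m) (g : Lp ℝ 1 m),
      Measurable fun t : Set.Ioi (0:ℝ) => pairing (T t f) g)
    (hcontr : ∀ t : ℝ, 0 < t → ‖T t‖ ≤ 1)
    (hadj : ∀ t : ℝ, 0 < t → ∀ g : Lp ℝ 1 m, ∃ g' : Lp ℝ 1 m,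
      ∀ f, pairing (T t f) g = pairing f g')
    (f : Lp ℝ ⊤ m) (g : Lp ℝ 1 m) {t : ℝ} (ht : 0 < t) :
    ContinuousAt (fun t => pairing (T t f) g) t := by
  have hadj' : ∀ t : ℝ, ∃ g' : Lp ℝ 1 m, 0 < t → ∀ f, pairing (T t f) g = pairing f g' := by
    intro t
    by_cases h : 0 < t
    · obtain ⟨g', hg'⟩ := hadj t h g
      exact ⟨g', fun _ => hg'⟩
    · exact ⟨0, fun h' => absurd h' h⟩
  choose G hG using hadj'
  obtain ⟨φ, hφ, hnorm⟩ := exists_norming_seq (m := m)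
  rw [Metric.continuousAt_iff']
  intro ε hε
  obtain ⟨δ, hδ, hδε⟩ : ∃ δ > 0, ‖f‖ * (2 * δ) < ε := by
    refine ⟨ε / (2 * (‖f‖ + 1)), by positivity, ?_⟩
    rw [← mul_div_assoc, mul_div_mul_left _ _ two_ne_zero, ← mul_div_assoc,
      div_lt_iff₀ (by positivity)]
    nlinarith
  set d := TopologicalSpace.denseSeq (Lp ℝ 1 m)
  let A : ℕ → Set ℝ := fun i =>
    Set.Ioo 0 t ∩ Subtype.val ''
      {ξ : Set.Ioi (0:ℝ) | ∀ n, |pairing (T ξ (φ n)) g - pairing (φ n) (d i)| ≤ δ}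
  have hAm : ∀ i, MeasurableSet (A i) := by
    intro i
    refine measurableSet_Ioo.inter (measurableSet_Ioi.subtype_image ?_)
    rw [Set.ofPred_forall]
    exact MeasurableSet.iInter fun n =>
      measurableSet_le ((hmeas (φ n) g).sub_const _).abs measurable_const
  have hAG : ∀ i, ∀ ξ ∈ A i, ‖G ξ - d i‖ ≤ δ := by
    rintro i _ ⟨-, ξ, hξ, rfl⟩
    refine hnorm _ _ fun n => ?_
    rw [pairing_sub_right, ← hG ξ ξ.2]
    exact hξ n
  have hcover : Set.Ioo 0 t ⊆ ⋃ i, A i := by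
    intro ξ hξ
    obtain ⟨i, hi⟩ := (TopologicalSpace.denseRange_denseSeq (Lp ℝ 1 m)).exists_dist_lt (G ξ) hδ
    refine Set.mem_iUnion.2 ⟨i, hξ, ⟨ξ, hξ.1⟩, fun n => ?_, rfl⟩
    rw [hG ξ hξ.1, ← pairing_sub_right]
    rw [dist_eq_norm] at hi
    exact (abs_pairing_le _ _).trans
      ((mul_le_of_le_one_left (norm_nonneg _) (hφ n)).trans hi.le)
  obtain ⟨i, hi⟩ : ∃ i, 0 < volume (A i) := by
    by_contra! h
    have h0 : volume (Set.Ioo 0 t) = 0 :=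
      measure_mono_null hcover (measure_iUnion_null fun i => le_antisymm (h i) bot_le)
    rw [Real.volume_Ioo, ENNReal.ofReal_eq_zero] at h0
    linarith
  have hsteinhaus := Measure.sub_mem_nhds_zero_of_addHaar_pos volume (A i) (hAm i) hi
  have hsub : Tendsto (fun t' : ℝ => t' - t) (𝓝 t) (𝓝 0) := by
    simpa using (continuous_sub_right t).tendsto t
  filter_upwards [hsub hsteinhaus] with t' ht'
  obtain ⟨a, ha, b, hb, hab⟩ := ht'
  have hr : 0 < t - b := sub_pos.2 hb.1.2
  have h1 : ∀ c, 0 < c → pairing (T (c + (t - b)) f) g = pairing (T (t - b) f) (G c) := by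
    intro c hc
    rw [hsg c _ hc hr, ContinuousLinearMap.comp_apply, hG c hc]
  have e1 := h1 a ha.1.1
  have e2 := h1 b hb.1.1
  rw [show a + (t - b) = t' by dsimp only at hab; linarith] at e1
  rw [add_sub_cancel] at e2
  rw [Real.dist_eq, e1, e2, ← pairing_sub_right]
  refine lt_of_le_of_lt ((abs_pairing_le _ _).trans ?_) hδε
  have h2 : ‖T (t - b) f‖ ≤ ‖f‖ :=
    ((T (t - b)).le_of_opNorm_le (hcontr _ hr) f).trans (one_mul _).le
  have h3 : ‖G a - G b‖ ≤ 2 * δ := by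
    have := norm_sub_le_norm_sub_add_norm_sub (G a) (d i) (G b)
    have h4 := hAG i a ha
    have h5 := hAG i b hb
    rw [norm_sub_rev] at h5
    linarith
  exact mul_le_mul h2 h3 (norm_nonneg _) (norm_nonneg _)

end Duality

section Operator

variable [MetricSpace E] [MeasurableSpace E] [BorelSpace E] {m : Measure E}

/-- Let `K` be a positive strong Feller operator with continuous representatives `Kc`. If the
images `K fs n` are bounded and converge pointwise everywhere to `K f`, then a second application
of `K` converges along every convergent sequence of points. -/
theorem tendsto_strongFeller_sq [m.IsOpenPosMeasure] (K : Lp ℝ ⊤ m →L[ℝ] Lp ℝ ⊤ m)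
    (hpos : ∀ f : Lp ℝ ⊤ m, (0 ≤ᵐ[m] (f : E → ℝ)) → 0 ≤ᵐ[m] (K f : E → ℝ))
    {Kc : Lp ℝ ⊤ m → BoundedContinuousFunction E ℝ}
    (hKc : ∀ f : Lp ℝ ⊤ m, (K f : E → ℝ) =ᵐ[m] (Kc f : E → ℝ))
    (hsf : ∀ (fs : ℕ → Lp ℝ ⊤ m) (f : Lp ℝ ⊤ m), (∃ C : ℝ, ∀ n, ‖fs n‖ ≤ C) →
      (∀ᵐ x ∂m, Tendsto (fun n => (fs n : E → ℝ) x) atTop (𝓝 ((f : E → ℝ) x))) →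
      ∀ x, Tendsto (fun n => Kc (fs n) x) atTop (𝓝 (Kc f x)))
    {fs : ℕ → Lp ℝ ⊤ m} {f : Lp ℝ ⊤ m} {C : ℝ} (hC : ∀ n, ‖fs n‖ ≤ C)
    (hlim : ∀ x, Tendsto (fun n => Kc (fs n) x) atTop (𝓝 (Kc f x)))
    {xs : ℕ → E} {x : E} (hx : Tendsto xs atTop (𝓝 x)) :
    Tendsto (fun n => Kc (K (fs n)) (xs n)) atTop (𝓝 (Kc (K f) x)) := by
  have hsub : ∀ f g : Lp ℝ ⊤ m, ∀ y, Kc (f - g) y = Kc f y - Kc g y := by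
    intro f g
    refine congrFun (((Kc (f - g)).continuous.ae_eq_iff_eq m
      ((Kc f).continuous.sub (Kc g).continuous)).1 ?_)
    have h := hKc (f - g)
    rw [map_sub] at h
    filter_upwards [h, Lp.coeFn_sub (K f) (K g), hKc f, hKc g] with y h1 h2 h3 h4
    rw [← h1, h2, Pi.sub_apply, h3, h4]
    rfl
  have hzero : ∀ y, Kc 0 y = 0 := fun y => by simpa using hsub 0 0 y
  have hnonneg : ∀ f : Lp ℝ ⊤ m, (0 ≤ᵐ[m] (f : E → ℝ)) → ∀ y, 0 ≤ Kc f y := by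
    intro f hf y
    have h1 : ∀ᵐ y ∂m, 0 ≤ Kc f y := by
      filter_upwards [hpos f hf, hKc f] with y h1 h2
      rwa [← h2]
    have h2 := (Measure.dense_of_ae h1).closure_eq
    rw [(isClosed_le continuous_const (Kc f).continuous).closure_eq] at h2
    exact (Set.ext_iff.1 h2 y).2 trivial
  have hmono : ∀ {f g : Lp ℝ ⊤ m}, (f : E → ℝ) ≤ᵐ[m] g → ∀ y, Kc f y ≤ Kc g y := by
    intro f g hfg y
    rw [← sub_nonneg, ← hsub]
    refine hnonneg _ ?_ y
    filter_upwards [hfg, Lp.coeFn_sub g f] with y h1 h2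
    rw [h2]
    exact sub_nonneg.2 h1
  have hbound : ∀ (f : Lp ℝ ⊤ m) (y : E), |Kc f y| ≤ ‖K‖ * ‖f‖ := by
    intro f y
    have h1 : ∀ᵐ y ∂m, |Kc f y| ≤ ‖K‖ * ‖f‖ := by
      filter_upwards [ae_abs_le_norm (K f), hKc f] with y h1 h2
      rw [← h2]
      exact h1.trans (K.le_opNorm f)
    have h2 := (Measure.dense_of_ae h1).closure_eq
    rw [(isClosed_le (Kc f).continuous.abs continuous_const).closure_eq] at h2
    exact (Set.ext_iff.1 h2 y).2 trivial
  set D := ‖K‖ * (C + ‖f‖) with hDdef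
  have hD : 0 ≤ D :=
    mul_nonneg (norm_nonneg _) (add_nonneg ((norm_nonneg _).trans (hC 0)) (norm_nonneg _))
  have hdiff : ∀ n y, |Kc (fs n) y - Kc f y| ≤ D := by
    intro n y
    rw [← hsub]
    exact (hbound _ _).trans (mul_le_mul_of_nonneg_left
      ((norm_sub_le _ _).trans (add_le_add_left (hC n) _)) (norm_nonneg _))
  let h : ℕ → E → ℝ := fun k y => ⨆ n, |Kc (fs (n + k)) y - Kc f y|
  have hle : ∀ k n y, k ≤ n → |Kc (fs n) y - Kc f y| ≤ h k y := by
    intro k n y hkn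
    obtain ⟨j, rfl⟩ := Nat.exists_eq_add_of_le' hkn
    exact le_ciSup (f := fun n => |Kc (fs (n + k)) y - Kc f y|)
      ⟨D, Set.forall_mem_range.2 fun n => hdiff _ y⟩ j
  have h0 : ∀ k y, 0 ≤ h k y := fun k y => (abs_nonneg _).trans (hle k k y le_rfl)
  have hhm : ∀ k, Measurable (h k) := fun k => Measurable.iSup fun n =>
    ((Kc (fs (n + k))).continuous.sub (Kc f).continuous).abs.measurable
  choose H hH hHD using fun k => exists_Linf_of_bound (m := m) (hhm k) hD
    fun y => by rw [abs_of_nonneg (h0 k y)]; exact ciSup_le fun n => hdiff _ y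
  have hHlim : ∀ᵐ y ∂m, Tendsto (fun k => (H k : E → ℝ) y) atTop
      (𝓝 (((0 : Lp ℝ ⊤ m) : E → ℝ) y)) := by
    filter_upwards [ae_all_iff.2 hH, Lp.coeFn_zero ℝ ⊤ m] with y h1 h2
    simp only [h1, h2, Pi.zero_apply]
    rw [Metric.tendsto_atTop]
    intro ε hε
    obtain ⟨N, hN⟩ := Metric.tendsto_atTop.1 (hlim y) (ε / 2) (half_pos hε)
    refine ⟨N, fun k hk => ?_⟩
    rw [Real.dist_eq, sub_zero, abs_of_nonneg (h0 k y)]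
    exact (ciSup_le fun n => (hN (n + k) (by omega)).le).trans_lt (half_lt_self hε)
  have hKH := hsf H 0 ⟨D, hHD⟩ hHlim
  have hdom : ∀ k n y, k ≤ n → |Kc (K (fs n)) y - Kc (K f) y| ≤ Kc (H k) y := by
    intro k n y hkn
    rw [abs_le', neg_sub, ← hsub, ← hsub]
    constructor <;> refine hmono ?_ y
    · filter_upwards [Lp.coeFn_sub (K (fs n)) (K f), hKc (fs n), hKc f, hH k] with z h1 h2 h3 h4
      rw [h1, Pi.sub_apply, h2, h3, h4]
      exact (le_abs_self _).trans (hle k n z hkn)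
    · filter_upwards [Lp.coeFn_sub (K f) (K (fs n)), hKc (fs n), hKc f, hH k] with z h1 h2 h3 h4
      rw [h1, Pi.sub_apply, h2, h3, h4, ← neg_sub]
      exact (neg_le_abs _).trans (hle k n z hkn)
  have hconv : Tendsto (fun n => Kc (K (fs n)) (xs n) - Kc (K f) (xs n)) atTop (𝓝 0) := by
    rw [Metric.tendsto_nhds]
    intro ε hε
    obtain ⟨k, hk⟩ := ((hKH x).eventually_lt_const (by rwa [hzero x])).exists
    filter_upwards [(((Kc (H k)).continuous.tendsto x).comp hx).eventually_lt_const hk,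
      eventually_ge_atTop k] with n h1 h2
    rw [Real.dist_eq, sub_zero]
    exact (hdom k n _ h2).trans_lt h1
  simpa using hconv.add (((Kc (K f)).continuous.tendsto x).comp hx)

end Operator

end StrongFeller

/-- Let `E` be Polish and `m` a σ-finite Borel measure with full support.
Let `(T(t))_{t>0}` be an injective and contractive `*`-semigroup on `L∞(E, m)` such that
every `T(t)` (`t > 0`) is a positive strong Feller operator, with continuous representatives
`Tc t f`. Then for every `f ∈ L∞(E, m)` the map `(0,∞) × E → ℝ`, `(t, x) ↦ (T(t)f)(x)`,
is jointly continuous. -/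
theorem strongFellerSemigroup_joint_continuity
    [MetricSpace E] [CompleteSpace E] [TopologicalSpace.SeparableSpace E]
    [MeasurableSpace E] [BorelSpace E]
    (m : MeasureTheory.Measure E) [MeasureTheory.SigmaFinite m]
    (hfull : ∀ (x : E) (r : ℝ), 0 < r → 0 < m (Metric.ball x r))
    (T : ℝ → MeasureTheory.Lp ℝ ⊤ m →L[ℝ] MeasureTheory.Lp ℝ ⊤ m)
    (hw : ∀ t : ℝ, 0 < t → @Continuous _ _ (weakStarLinf m) (weakStarLinf m) (T t))
    (hsg : ∀ t s : ℝ, 0 < t → 0 < s → T (t + s) = (T t).comp (T s))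
    (hmeas : ∀ (f : MeasureTheory.Lp ℝ ⊤ m) (g : MeasureTheory.Lp ℝ 1 m),
      Measurable ((Set.Ioi (0:ℝ)).restrict
        fun t => ∫ x, (T t f : E → ℝ) x * (g : E → ℝ) x ∂m))
    (hcontr : ∀ t : ℝ, 0 < t → ‖T t‖ ≤ 1)
    (hinj : ∀ f : MeasureTheory.Lp ℝ ⊤ m, (∀ t : ℝ, 0 < t → T t f = 0) → f = 0)
    (hpos : ∀ t : ℝ, 0 < t → ∀ f : MeasureTheory.Lp ℝ ⊤ m,
      (0 ≤ᵐ[m] (f : E → ℝ)) → 0 ≤ᵐ[m] (T t f : E → ℝ))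
    (Tc : ℝ → MeasureTheory.Lp ℝ ⊤ m → BoundedContinuousFunction E ℝ)
    (hTc : ∀ t : ℝ, 0 < t → ∀ f : MeasureTheory.Lp ℝ ⊤ m,
      (T t f : E → ℝ) =ᵐ[m] (Tc t f : E → ℝ))
    (hsf : ∀ t : ℝ, 0 < t →
      ∀ (fs : ℕ → MeasureTheory.Lp ℝ ⊤ m) (f : MeasureTheory.Lp ℝ ⊤ m),
        (∃ C : ℝ, ∀ n, ‖fs n‖ ≤ C) →
        (∀ᵐ x ∂m, Filter.Tendsto (fun n => (fs n : E → ℝ) x) Filter.atTop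
          (nhds ((f : E → ℝ) x))) →
        ∀ x, Filter.Tendsto (fun n => Tc t (fs n) x) Filter.atTop (nhds (Tc t f x))) :
    ∀ f : MeasureTheory.Lp ℝ ⊤ m,
      ContinuousOn (fun p : ℝ × E => Tc p.1 f p.2)
        (Set.Ioi (0:ℝ) ×ˢ (Set.univ : Set E)) := by
  have : m.IsOpenPosMeasure := ⟨fun U hU ⟨x, hx⟩ h0 => by
    obtain ⟨r, hr, hrU⟩ := Metric.isOpen_iff.1 hU x hx
    exact (hfull x r hr).ne' (measure_mono_null hrU h0)⟩
  have : SecondCountableTopology E := UniformSpace.secondCountable_of_separable E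
  have : Fact ((1 : ENNReal) ≠ ⊤) := ⟨ENNReal.one_ne_top⟩
  have hadd : ∀ t, 0 < t → ∀ f g : Lp ℝ ⊤ m, ∀ x, Tc t (f + g) x = Tc t f x + Tc t g x := by
    intro t ht f g
    refine congrFun (((Tc t (f + g)).continuous.ae_eq_iff_eq m
      ((Tc t f).continuous.add (Tc t g).continuous)).1 ?_)
    have h := hTc t ht (f + g)
    rw [map_add] at h
    filter_upwards [h, Lp.coeFn_add (T t f) (T t g), hTc t ht f, hTc t ht g] with x h1 h2 h3 h4
    rw [← h1, h2, Pi.add_apply, h3, h4]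
    rfl
  have hsmul : ∀ t, 0 < t → ∀ (c : ℝ) (f : Lp ℝ ⊤ m), ∀ x, Tc t (c • f) x = c * Tc t f x := by
    intro t ht c f
    refine congrFun (((Tc t (c • f)).continuous.ae_eq_iff_eq m
      (continuous_const.mul (Tc t f).continuous)).1 ?_)
    have h := hTc t ht (c • f)
    rw [map_smul] at h
    filter_upwards [h, Lp.coeFn_smul c (T t f), hTc t ht f] with x h1 h2 h3
    rw [← h1, h2, Pi.smul_apply, h3, smul_eq_mul]
    rfl
  have hle : ∀ t, 0 < t → ∀ f, ‖T t f‖ ≤ ‖f‖ := fun t ht f =>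
    ((T t).le_of_opNorm_le (hcontr t ht) f).trans (one_mul _).le
  have hkernel : ∀ t, 0 < t → ∀ x, ∃ k : Lp ℝ 1 m, ∀ f,
      Tc t f x = StrongFeller.pairing f k := fun t ht x =>
    StrongFeller.exists_pairing_of_sigma_continuous
      { toFun := fun f => Tc t f x
        map_add' := fun f g => hadd t ht f g x
        map_smul' := fun c f => hsmul t ht c f x } fun fs f hC h => hsf t ht fs f hC h x
  have hadj : ∀ t, 0 < t → ∀ g : Lp ℝ 1 m, ∃ g' : Lp ℝ 1 m, ∀ f,
      StrongFeller.pairing (T t f) g = StrongFeller.pairing f g' := by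
    intro t ht g
    refine StrongFeller.exists_pairing_of_sigma_continuous
      { toFun := fun f => StrongFeller.pairing (T t f) g
        map_add' := fun f f' => by rw [map_add, StrongFeller.pairing_add_left]
        map_smul' := fun c f => by
          rw [map_smul, StrongFeller.pairing_smul_left, RingHom.id_apply, smul_eq_mul] } ?_
    rintro fs f ⟨C, hC⟩ h
    refine StrongFeller.tendsto_pairing (fun n => (hle t ht _).trans (hC n)) ?_ g
    filter_upwards [ae_all_iff.2 fun n => hTc t ht (fs n), hTc t ht f] with x h1 h2
    simp only [h1, h2]
    exact hsf t ht fs f ⟨C, hC⟩ h x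
  have hcont : ∀ (f : Lp ℝ ⊤ m) (g : Lp ℝ 1 m) (t : ℝ), 0 < t →
      ContinuousAt (fun t => StrongFeller.pairing (T t f) g) t := fun f g t ht =>
    StrongFeller.continuousAt_pairing_semigroup hsg hmeas hcontr hadj f g ht
  have hfactor : ∀ s r : ℝ, 0 < s → 0 < r → ∀ f, Tc (s + (s + r)) f = Tc s (T s (T r f)) := by
    intro s r hs hr f
    refine DFunLike.coe_injective (((Tc _ f).continuous.ae_eq_iff_eq m
      (Tc s _).continuous).1 ?_)
    have h := hTc (s + (s + r)) (by positivity) f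
    rw [hsg s (s + r) hs (by positivity), hsg s r hs hr] at h
    exact h.symm.trans (hTc s hs _)
  rintro f ⟨t, x⟩ ⟨ht, -⟩
  have ht : 0 < t := ht
  refine tendsto_of_seq_tendsto fun p hp => ?_
  have hp' : Tendsto p atTop (𝓝 (t, x)) := hp.mono_right nhdsWithin_le_nhds
  have hp1 : Tendsto (fun n => (p n).1) atTop (𝓝 t) := (continuous_fst.tendsto _).comp hp'
  have hp2 : Tendsto (fun n => (p n).2) atTop (𝓝 x) := (continuous_snd.tendsto _).comp hp'
  obtain ⟨s, hs, hst⟩ : ∃ s : ℝ, 0 < s ∧ t = 4 * s := ⟨t / 4, by positivity, by ring⟩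
  let τ : ℕ → ℝ := fun n => max ((p n).1 - 2 * s) s
  have hτ0 : ∀ n, 0 < τ n := fun n => lt_max_of_lt_right hs
  have hτ : Tendsto τ atTop (𝓝 (2 * s)) := by
    have := (hp1.sub_const (2 * s)).max (tendsto_const_nhds (x := s))
    rwa [max_eq_left (by linarith), show t - 2 * s = 2 * s by linarith] at this
  have hlim : ∀ y, Tendsto (fun n => Tc s (T (τ n) f) y) atTop (𝓝 (Tc s (T (2 * s) f) y)) := by
    intro y
    obtain ⟨k, hk⟩ := hkernel s hs y
    simp only [hk]
    exact (hcont f k (2 * s) (by positivity)).tendsto.comp hτ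
  have hmain := StrongFeller.tendsto_strongFeller_sq (T s) (hpos s hs) (hTc s hs) (hsf s hs)
    (fun n => hle (τ n) (hτ0 n) f) hlim hp2
  rw [← hfactor s (2 * s) hs (by positivity), show s + (s + 2 * s) = t by linarith] at hmain
  refine hmain.congr' ?_
  filter_upwards [hp1.eventually_const_lt (show 3 * s < t by linarith)] with n hn
  rw [← hfactor s (τ n) hs (hτ0 n), show s + (s + τ n) = (p n).1 by
    simp only [τ]
    rw [max_eq_left (by linarith)]
    ring]
  rfl
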